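/- Let N ∈ ℝ^{n × n} be symmetric positive semidefinite and P ∈ ℝ^{M × M} symmetric positive definite. Let G : ℝ → ℝ^{n × M} be differentiable at x₀ ∈ ℝ with derivative G′, and set Σ(x) := (G(x)ᵀ N G(x) + P)⁻¹. Then the A-optimal design utility x ↦ trace(Σ(x)) is differentiable at x₀ with derivative −2 · trace( Σ(x₀) G(x₀)ᵀ N G′ Σ(x₀) ). -/

import Mathlib

open Matrix

attribute [local instance] Matrix.frobeniusSeminormedAddCommGroup
  Matrix.frobeniusNormedAddCommGroup Matrix.frobeniusNormedSpace

/-- Product rule for products of rectangular matrices. -/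
theorem hasDerivAt_matrix_mul {l m n : ℕ} {A : ℝ → Matrix (Fin l) (Fin m) ℝ}
    {B : ℝ → Matrix (Fin m) (Fin n) ℝ} {A' : Matrix (Fin l) (Fin m) ℝ}
    {B' : Matrix (Fin m) (Fin n) ℝ} {x : ℝ} (hA : HasDerivAt A A' x) (hB : HasDerivAt B B' x) :
    HasDerivAt (fun y => A y * B y) (A x * B' + A' * B x) x := by
  let f : Matrix (Fin l) (Fin m) ℝ →ₗ[ℝ] Matrix (Fin m) (Fin n) ℝ →ₗ[ℝ]
      Matrix (Fin l) (Fin n) ℝ :=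
    LinearMap.mk₂ ℝ (fun X Y => X * Y) Matrix.add_mul (fun c X Y => Matrix.smul_mul c X Y)
      Matrix.mul_add (fun c X Y => Matrix.mul_smul X c Y)
  let F := f.mkContinuous₂ 1 fun X Y => by simpa [f] using Matrix.frobenius_norm_mul X Y
  refine (F.hasFDerivAt_of_bilinear hA.hasFDerivAt hB.hasFDerivAt).hasDerivAt.congr_deriv ?_
  change A x * ((1 : ℝ) • B') + ((1 : ℝ) • A') * B x = _
  simp only [one_smul]

/-- Derivative of the inverse of a curve of matrices at a point where it is invertible. -/
theorem hasDerivAt_matrix_inv {n : ℕ} {A : ℝ → Matrix (Fin n) (Fin n) ℝ}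
    {A' : Matrix (Fin n) (Fin n) ℝ} {x : ℝ} (hA : HasDerivAt A A' x) (hx : IsUnit (A x)) :
    HasDerivAt (fun y => (A y)⁻¹) (-((A x)⁻¹ * A' * (A x)⁻¹)) x := by
  let : NormedRing (Matrix (Fin n) (Fin n) ℝ) := Matrix.frobeniusNormedRing
  let : NormedAlgebra ℝ (Matrix (Fin n) (Fin n) ℝ) := Matrix.frobeniusNormedAlgebra
  obtain ⟨u, hu⟩ := hx
  have h := hasFDerivAt_ringInverse (𝕜 := ℝ) u
  rw [hu] at h
  have h' := h.comp_hasDerivAt x hA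
  simp only [Function.comp_def, ← Matrix.nonsing_inv_eq_ringInverse, Matrix.coe_units_inv, hu,
    _root_.neg_apply, ContinuousLinearMap.mulLeftRight_apply] at h'
  exact h'

/-- For `N` symmetric positive semidefinite, `P` symmetric positive
definite, `G : ℝ → ℝ^{n×M}` differentiable at `x₀` with derivative `G'`, and
`Σ(x) = (G(x)ᵀNG(x) + P)⁻¹`, the A-optimal design utility `x ↦ trace(Σ(x))` is
differentiable at `x₀` with derivative `−2 trace(Σ(x₀) G(x₀)ᵀ N G' Σ(x₀))`. -/
theorem stmt_8 {n M : ℕ}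
    (N : Matrix (Fin n) (Fin n) ℝ) (hN : N.PosSemidef)
    (P : Matrix (Fin M) (Fin M) ℝ) (hP : P.PosDef)
    (G : ℝ → Matrix (Fin n) (Fin M) ℝ) (G' : Matrix (Fin n) (Fin M) ℝ)
    (x₀ : ℝ) (hG : HasDerivAt G G' x₀)
    (Sig : ℝ → Matrix (Fin M) (Fin M) ℝ)
    (hSig : ∀ x, Sig x = ((G x)ᵀ * N * G x + P)⁻¹) :
    HasDerivAt (fun x => (Sig x).trace)
      (-2 * (Sig x₀ * (G x₀)ᵀ * N * G' * Sig x₀).trace) x₀ := by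
  have hT : HasDerivAt (fun x => (G x)ᵀ) G'ᵀ x₀ :=
    (Matrix.transposeLinearEquiv (Fin n) (Fin M) ℝ
      ℝ).toLinearMap.toContinuousLinearMap.hasFDerivAt.comp_hasDerivAt x₀ hG
  have hA : HasDerivAt (fun x => (G x)ᵀ * N * G x + P)
      ((G x₀)ᵀ * N * G' + G'ᵀ * N * G x₀) x₀ := by
    refine ((hasDerivAt_matrix_mul
      (hasDerivAt_matrix_mul hT (hasDerivAt_const x₀ N)) hG).add_const P).congr_deriv ?_
    simp
  have hpsd : ((G x₀)ᵀ * N * G x₀).PosSemidef := by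
    simpa using hN.conjTranspose_mul_mul_same (G x₀)
  have hpd : ((G x₀)ᵀ * N * G x₀ + P).PosDef := hP.posSemidef_add hpsd
  have hNt : Nᵀ = N := by simpa using hN.isHermitian.eq
  have hSt : (Sig x₀)ᵀ = Sig x₀ := by
    rw [hSig]
    simpa using hpd.inv.isHermitian.eq
  have hS := hasDerivAt_matrix_inv hA hpd.isUnit
  simp only [← hSig] at hS
  have htr : HasDerivAt (fun x => (Sig x).trace)
      (-(Sig x₀ * ((G x₀)ᵀ * N * G' + G'ᵀ * N * G x₀) * Sig x₀)).trace x₀ :=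
    (Matrix.traceLinearMap (Fin M) ℝ ℝ).toContinuousLinearMap.hasFDerivAt.comp_hasDerivAt x₀ hS
  refine htr.congr_deriv ?_
  have hsymm : (Sig x₀ * (G'ᵀ * N * G x₀) * Sig x₀).trace =
      (Sig x₀ * (G x₀)ᵀ * N * G' * Sig x₀).trace := by
    rw [← Matrix.trace_transpose]
    simp only [Matrix.transpose_mul, Matrix.transpose_transpose, hSt, hNt, Matrix.mul_assoc]
  rw [Matrix.trace_neg, Matrix.mul_add, Matrix.add_mul, Matrix.trace_add, hsymm]
  simp only [Matrix.mul_assoc]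
  ring
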